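/- (Error decomposition of Algorithm 2 under noise.) Let the signals satisfy x(k+1) = A x(k) + B u(k) + E v(k), y(k) = C x(k) + F w(k), suppose U_p U_p^T is invertible, set U_po = I_L − U_p^T (U_p U_p^T)^{-1} U_p, suppose G = (X U_po)(X U_po)^T is invertible, and define the estimate Ô = (Y_p U_po)(X U_po)^T G^{-1}. Then the estimation error decomposes exactly as Ô − O_N = S_E (V_p U_po)(X U_po)^T G^{-1} + (I_N ⊗ F)(W_p U_po)(X U_po)^T G^{-1}; in particular the term involving the input Toeplitz matrix S_N is eliminated because U_p U_po = 0. -/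

import Mathlib

open Matrix

/-- Extended observability matrix `O_N` with `i`-th block row `C * A ^ i` (0-based). -/
def obsMat {n q : ℕ} (A : Matrix (Fin n) (Fin n) ℝ) (C : Matrix (Fin q) (Fin n) ℝ)
    (N : ℕ) : Matrix (Fin N × Fin q) (Fin n) ℝ :=
  fun ia j => (C * A ^ (ia.1 : ℕ)) ia.2 j

/-- Block lower-triangular Toeplitz matrix with `(i,j)` block `C * A ^ (i - j - 1) * B`
for `i > j` (0-based), and `0` otherwise. -/
def toepMat {n p q : ℕ} (A : Matrix (Fin n) (Fin n) ℝ) (B : Matrix (Fin n) (Fin p) ℝ)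
    (C : Matrix (Fin q) (Fin n) ℝ) (N : ℕ) : Matrix (Fin N × Fin q) (Fin N × Fin p) ℝ :=
  fun ia jb =>
    if (jb.1 : ℕ) < (ia.1 : ℕ) then
      (C * A ^ ((ia.1 : ℕ) - (jb.1 : ℕ) - 1) * B) ia.2 jb.2
    else 0

/-- Block Hankel matrix of a signal `e`, starting at time `k`, with `N` block rows and `L`
columns: its block `(i,j)` (0-based) is `e (k + i + j)`. -/
def hankelMat {d : ℕ} (e : ℕ → Fin d → ℝ) (k N L : ℕ) : Matrix (Fin N × Fin d) (Fin L) ℝ :=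
  fun ia j => e (k + (ia.1 : ℕ) + (j : ℕ)) ia.2

/-- State data matrix `X = [x(0) x(1) ⋯ x(L-1)]`. -/
def stateMat {n : ℕ} (x : ℕ → Fin n → ℝ) (L : ℕ) : Matrix (Fin n) (Fin L) ℝ :=
  fun i j => x (j : ℕ) i

/-- Kronecker product `I_N ⊗ F`: block-diagonal matrix with `N` copies of `F`. -/
def blkDiagRect {q r : ℕ} (F : Matrix (Fin q) (Fin r) ℝ) (N : ℕ) :
    Matrix (Fin N × Fin q) (Fin N × Fin r) ℝ :=
  fun ia jb => if ia.1 = jb.1 then F ia.2 jb.2 else 0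

/-- Variation of constants for the linear recursion `x (k + 1) = A x k + f k`. -/
theorem mulVec_recursion_solution {n : ℕ} (A : Matrix (Fin n) (Fin n) ℝ)
    (x f : ℕ → Fin n → ℝ) (h : ∀ k, x (k + 1) = A *ᵥ x k + f k) (i k : ℕ) :
    x (i + k) = (A ^ i) *ᵥ x k + ∑ l ∈ Finset.range i, (A ^ (i - l - 1)) *ᵥ f (l + k) := by
  induction i with
  | zero => simp
  | succ i ih =>
    have hsum : ∑ l ∈ Finset.range i, (A ^ (i + 1 - l - 1)) *ᵥ f (l + k) =
        A *ᵥ ∑ l ∈ Finset.range i, (A ^ (i - l - 1)) *ᵥ f (l + k) := by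
      rw [mulVec_sum]
      refine Finset.sum_congr rfl fun l hl => ?_
      have hli := Finset.mem_range.mp hl
      rw [mulVec_mulVec, ← pow_succ', show i + 1 - l - 1 = i - l - 1 + 1 by omega]
    rw [Nat.add_right_comm, h, ih, Finset.sum_range_succ, hsum, mulVec_add, mulVec_mulVec,
      ← pow_succ', show i + 1 - i - 1 = 0 by omega, pow_zero, one_mulVec, add_assoc]

theorem toepMat_mul_hankelMat_apply {n p q : ℕ} (A : Matrix (Fin n) (Fin n) ℝ)
    (B : Matrix (Fin n) (Fin p) ℝ) (C : Matrix (Fin q) (Fin n) ℝ) (u : ℕ → Fin p → ℝ)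
    (N L : ℕ) (i : Fin N) (a : Fin q) (j : Fin L) :
    (toepMat A B C N * hankelMat u 0 N L) (i, a) j =
      (C *ᵥ ∑ l ∈ Finset.range i, (A ^ ((i : ℕ) - l - 1)) *ᵥ (B *ᵥ u (l + j))) a := by
  have hblock (l : Fin N) :
      ∑ b, toepMat A B C N (i, a) (l, b) * hankelMat u 0 N L (l, b) j =
        if (l : ℕ) < i then ((C * A ^ ((i : ℕ) - l - 1) * B) *ᵥ u (l + j)) a else 0 := by
    by_cases hl : (l : ℕ) < i <;> simp [toepMat, hankelMat, hl, mulVec, dotProduct]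
  rw [mul_apply, Fintype.sum_prod_type, Finset.sum_congr rfl fun l _ => hblock l,
    Fin.sum_univ_eq_sum_range
      (fun l => if l < (i : ℕ) then ((C * A ^ ((i : ℕ) - l - 1) * B) *ᵥ u (l + j)) a else 0),
    ← Finset.sum_filter,
    show (Finset.range N).filter (· < (i : ℕ)) = Finset.range i by
      ext l; simp only [Finset.mem_filter, Finset.mem_range]; omega,
    mulVec_sum, Finset.sum_apply]
  simp only [mulVec_mulVec, Matrix.mul_assoc]

theorem blkDiagRect_mul_hankelMat_apply {q r : ℕ} (F : Matrix (Fin q) (Fin r) ℝ)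
    (w : ℕ → Fin r → ℝ) (N L : ℕ) (i : Fin N) (a : Fin q) (j : Fin L) :
    (blkDiagRect F N * hankelMat w 0 N L) (i, a) j = (F *ᵥ w (i + j)) a := by
  rw [mul_apply, Fintype.sum_prod_type, Finset.sum_eq_single i]
  · simp [blkDiagRect, hankelMat, mulVec, dotProduct]
  · intro l _ hl
    simp [blkDiagRect, hl.symm]
  · simp

/-- The data equation relating the block Hankel matrices of the signals of a noisy linear
system. -/
theorem hankelMat_output_eq {n p q m r : ℕ}
    (A : Matrix (Fin n) (Fin n) ℝ) (B : Matrix (Fin n) (Fin p) ℝ)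
    (C : Matrix (Fin q) (Fin n) ℝ)
    (E : Matrix (Fin n) (Fin m) ℝ) (F : Matrix (Fin q) (Fin r) ℝ)
    (x : ℕ → Fin n → ℝ) (u : ℕ → Fin p → ℝ) (y : ℕ → Fin q → ℝ)
    (v : ℕ → Fin m → ℝ) (w : ℕ → Fin r → ℝ)
    (hdyn : ∀ k, x (k + 1) = A.mulVec (x k) + B.mulVec (u k) + E.mulVec (v k))
    (hout : ∀ k, y k = C.mulVec (x k) + F.mulVec (w k)) (N L : ℕ) :
    hankelMat y 0 N L =
      obsMat A C N * stateMat x L + toepMat A B C N * hankelMat u 0 N L +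
        toepMat A E C N * hankelMat v 0 N L + blkDiagRect F N * hankelMat w 0 N L := by
  ext ⟨i, a⟩ j
  have hobs : (obsMat A C N * stateMat x L) (i, a) j = (C *ᵥ ((A ^ (i : ℕ)) *ᵥ x j)) a := by
    rw [mulVec_mulVec]
    rfl
  have hx := mulVec_recursion_solution A x (fun k => B *ᵥ u k + E *ᵥ v k)
    (fun k => by rw [hdyn, add_assoc]) i j
  simp only [mulVec_add, Finset.sum_add_distrib] at hx
  rw [Matrix.add_apply, Matrix.add_apply, Matrix.add_apply, hobs, toepMat_mul_hankelMat_apply,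
    toepMat_mul_hankelMat_apply, blkDiagRect_mul_hankelMat_apply]
  simp only [hankelMat, zero_add, hout, hx, mulVec_add, Pi.add_apply, add_assoc]

/-- Error decomposition of Algorithm 2 under noise:
`Ô - O_N = S_E (V_p U_po)(X U_po)ᵀ G⁻¹ + (I_N ⊗ F)(W_p U_po)(X U_po)ᵀ G⁻¹`, the term
with the input Toeplitz matrix being eliminated because `U_p U_po = 0`. -/
theorem algorithm2_error_decomposition {n p q m r : ℕ}
    (A : Matrix (Fin n) (Fin n) ℝ) (B : Matrix (Fin n) (Fin p) ℝ)
    (C : Matrix (Fin q) (Fin n) ℝ)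
    (E : Matrix (Fin n) (Fin m) ℝ) (F : Matrix (Fin q) (Fin r) ℝ)
    (x : ℕ → Fin n → ℝ) (u : ℕ → Fin p → ℝ) (y : ℕ → Fin q → ℝ)
    (v : ℕ → Fin m → ℝ) (w : ℕ → Fin r → ℝ)
    (hdyn : ∀ k, x (k + 1) = A.mulVec (x k) + B.mulVec (u k) + E.mulVec (v k))
    (hout : ∀ k, y k = C.mulVec (x k) + F.mulVec (w k))
    (N L : ℕ) (hN : 1 ≤ N) (hL : 1 ≤ L)
    (hU : IsUnit (hankelMat u 0 N L * (hankelMat u 0 N L)ᵀ).det)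
    (Upo : Matrix (Fin L) (Fin L) ℝ)
    (hUpo : Upo = 1 - (hankelMat u 0 N L)ᵀ *
      (hankelMat u 0 N L * (hankelMat u 0 N L)ᵀ)⁻¹ * hankelMat u 0 N L)
    (hG : IsUnit ((stateMat x L * Upo) * (stateMat x L * Upo)ᵀ).det) :
    let X := stateMat x L
    let G := (X * Upo) * (X * Upo)ᵀ
    let Ohat := (hankelMat y 0 N L * Upo) * (X * Upo)ᵀ * G⁻¹
    hankelMat u 0 N L * Upo = 0 ∧
      Ohat - obsMat A C N =
        toepMat A E C N * (hankelMat v 0 N L * Upo) * (X * Upo)ᵀ * G⁻¹ +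
          blkDiagRect F N * (hankelMat w 0 N L * Upo) * (X * Upo)ᵀ * G⁻¹ := by
  intro X G Ohat
  have hUU : hankelMat u 0 N L * Upo = 0 := by
    rw [hUpo, Matrix.mul_sub, Matrix.mul_one, ← Matrix.mul_assoc, ← Matrix.mul_assoc,
      mul_nonsing_inv _ hU, Matrix.one_mul, sub_self]
  refine ⟨hUU, ?_⟩
  have hO : obsMat A C N * (X * Upo) * (X * Upo)ᵀ * G⁻¹ = obsMat A C N := by
    rw [Matrix.mul_assoc (obsMat A C N), Matrix.mul_assoc, mul_nonsing_inv _ hG,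
      Matrix.mul_one]
  have hY : hankelMat y 0 N L * Upo = obsMat A C N * (X * Upo) +
      toepMat A E C N * (hankelMat v 0 N L * Upo) +
      blkDiagRect F N * (hankelMat w 0 N L * Upo) := by
    rw [hankelMat_output_eq A B C E F x u y v w hdyn hout]
    simp only [Matrix.add_mul, Matrix.mul_assoc, hUU, Matrix.mul_zero, add_zero, X]
  simp only [Ohat]
  rw [hY, Matrix.add_mul, Matrix.add_mul, Matrix.add_mul, Matrix.add_mul, hO]
  abel
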